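/- For a function g_n satisfying the spherical Bessel recurrences g_n(r)/r = (g_{n-1}(r)+g_{n+1}(r))/(2n+1) and g_n'(r) = (n g_{n-1}(r) − (n+1) g_{n+1}(r))/(2n+1), and G(x) = g_n(k|x|) Y_n^m(x/|x|), the partial derivative with respect to x_3 satisfies ∂_{x_3} G(x) = k [ g_{n-1}(k r) e_{n-1}^m Y_{n-1}^m(θ,φ) − g_{n+1}(k r) f_{n+1}^m Y_{n+1}^m(θ,φ) ], where e_{n-1}^m = sqrt((n+m)(n−m)/((2n+1)(2n−1))) and f_{n+1}^m = sqrt((n+m+1)(n−m+1)/((2n+1)(2n+3))), r = |x|, and (θ,φ) the angular spherical coordinates of x. -/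

import Mathlib

open Real

/-- Legendre polynomial of degree `n` (Rodrigues formula). -/
noncomputable def legendreP (n : ℕ) (z : ℝ) : ℝ :=
  (1 / (2 ^ n * (Nat.factorial n : ℝ))) *
    iteratedDeriv n (fun x : ℝ => (x ^ 2 - 1) ^ n) z

/-- Associated Legendre function for `0 ≤ m ≤ n` (Condon–Shortley convention). -/
noncomputable def assocLegendreNat (n m : ℕ) (z : ℝ) : ℝ :=
  (-1 : ℝ) ^ m * (1 - z ^ 2) ^ ((m : ℝ) / 2) * iteratedDeriv m (legendreP n) z

/-- Associated Legendre function with integer degree and order, extended to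
negative orders by `P_n^{-m} = (-1)^m ((n-m)!/(n+m)!) P_n^m`, and taken to be
zero when the order exceeds the degree or the degree is negative. -/
noncomputable def assocLegendre (n m : ℤ) (z : ℝ) : ℝ :=
  if 0 ≤ n ∧ |m| ≤ n then
    if 0 ≤ m then assocLegendreNat n.toNat m.toNat z
    else (-1 : ℝ) ^ (-m).toNat *
      ((Nat.factorial (n + m).toNat : ℝ) / (Nat.factorial (n - m).toNat : ℝ)) *
      assocLegendreNat n.toNat (-m).toNat z
  else 0

/-- Normalization constant `γ_n^m = sqrt((2n+1)(n-m)!/(4π(n+m)!))`. -/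
noncomputable def sphGamma (n m : ℤ) : ℝ :=
  Real.sqrt ((2 * (n : ℝ) + 1) * (Nat.factorial (n - m).toNat : ℝ) /
    (4 * Real.pi * (Nat.factorial (n + m).toNat : ℝ)))

/-- Orthonormal spherical harmonic `Y_n^m(θ,φ) = γ_n^m e^{imφ} P_n^m(cos θ)`. -/
noncomputable def sphHarm (n m : ℤ) (θ φ : ℝ) : ℂ :=
  (sphGamma n m : ℂ) * Complex.exp (Complex.I * (m : ℂ) * (φ : ℂ)) *
    ((assocLegendre n m (Real.cos θ) : ℝ) : ℂ)

/-- `G(x) = g_n(k|x|) Y_n^m(x/|x|)`, with the angular spherical coordinates of `x`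
recovered as `θ = arccos(x₃/|x|)` and `φ = arg(x₁ + i x₂)`. -/
noncomputable def sphG (g : ℤ → ℝ → ℂ) (k : ℝ) (n m : ℤ)
    (x : EuclideanSpace ℝ (Fin 3)) : ℂ :=
  g n (k * ‖x‖) *
    sphHarm n m (Real.arccos (x 2 / ‖x‖)) (Complex.arg ((x 0 : ℂ) + (x 1 : ℂ) * Complex.I))


open Polynomial in
/-- Rodrigues polynomial. -/
noncomputable def legPoly (n : ℕ) : Polynomial ℝ :=
  C (1 / (2 ^ n * (Nat.factorial n : ℝ))) * derivative^[n] ((X ^ 2 - 1) ^ n)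

lemma iteratedDeriv_poly (p : Polynomial ℝ) (n : ℕ) :
    iteratedDeriv n (fun x : ℝ => p.eval x) =
      fun x => (Polynomial.derivative^[n] p).eval x := by
  induction n with
  | zero => simp
  | succ k ih =>
    rw [iteratedDeriv_succ, ih, Function.iterate_succ_apply']
    funext x
    simp

lemma legendreP_eq (n : ℕ) : legendreP n = fun x => (legPoly n).eval x := by
  funext z
  have h := iteratedDeriv_poly ((Polynomial.X ^ 2 - 1) ^ n) n
  simp only [Polynomial.eval_pow, Polynomial.eval_sub, Polynomial.eval_X, Polynomial.eval_one] at h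
  simp [legendreP, legPoly, h]

lemma assocLegendreNat_eq (n m : ℕ) (z : ℝ) : assocLegendreNat n m z =
    (-1 : ℝ) ^ m * (1 - z ^ 2) ^ ((m : ℝ) / 2) *
      (Polynomial.derivative^[m] (legPoly n)).eval z := by
  rw [assocLegendreNat, legendreP_eq, iteratedDeriv_poly]

lemma legPoly_top (n m : ℕ) (h : n < m) : Polynomial.derivative^[m] (legPoly n) = 0 := by
  rw [legPoly, Polynomial.iterate_derivative_C_mul, ← Function.iterate_add_apply,
    Polynomial.iterate_derivative_eq_zero, mul_zero]
  have h2 : ((Polynomial.X ^ 2 - 1 : Polynomial ℝ)).natDegree ≤ 2 := by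
    compute_degree
  have := Polynomial.natDegree_pow_le_of_le n h2
  omega

open Polynomial in
lemma itX (p : ℝ[X]) (k : ℕ) : derivative^[k + 1] (X * p) =
    X * derivative^[k + 1] p + C ((k : ℝ) + 1) * derivative^[k] p := by
  induction k with
  | zero => simp; ring
  | succ m ih =>
    have := congrArg derivative ih
    rw [← Function.iterate_succ_apply' (f := derivative)] at this
    rw [this]
    simp only [derivative_add, derivative_mul, derivative_X, derivative_C,
      ← Function.iterate_succ_apply' (f := derivative), Nat.succ_eq_add_one]
    push_cast [C_add, C_1]
    ring

open Polynomial in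
lemma itX' (p : ℝ[X]) (k : ℕ) : derivative^[k] (X * derivative p) =
    X * derivative^[k + 1] p + C (k : ℝ) * derivative^[k] p := by
  rcases k with _ | k
  · simp
  · rw [itX]
    simp only [← Function.iterate_succ_apply (f := derivative), Nat.succ_eq_add_one]
    push_cast
    ring

open Polynomial in
lemma leg_base1 (n : ℕ) : derivative (legPoly (n + 1)) =
    X * derivative (legPoly n) + C ((n : ℝ) + 1) * legPoly n := by
  have h1 : derivative ((X ^ 2 - 1 : ℝ[X]) ^ (n + 1)) = C (2 * ((n : ℝ) + 1)) * (X * (X ^ 2 - 1) ^ n) := by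
    simp [derivative_pow, C_mul, C_add]; ring
  have hC : (1 / (2 ^ (n + 1) * (Nat.factorial (n + 1) : ℝ))) * (2 * ((n : ℝ) + 1)) = 1 / (2 ^ n * (Nat.factorial n : ℝ)) := by
    rw [Nat.factorial_succ]; push_cast; field_simp; ring
  unfold legPoly
  rw [Function.iterate_succ_apply, h1, iterate_derivative_C_mul, ← mul_assoc, ← C_mul, hC]
  simp only [derivative_C_mul]
  rw [← Function.iterate_succ_apply' (f := derivative), ← Function.iterate_succ_apply' (f := derivative), itX]
  ring

open Polynomial in
lemma leg_base2 (n : ℕ) : (1 - X ^ 2) * derivative (legPoly n) =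
    C ((n : ℝ) + 1) * (X * legPoly n - legPoly (n + 1)) := by
  have h1 : derivative ((X ^ 2 - 1 : ℝ[X]) ^ (n + 1)) = C (2 * ((n : ℝ) + 1)) * (X * (X ^ 2 - 1) ^ n) := by
    simp [derivative_pow, C_mul, C_add]; ring
  have hC : (1 / (2 ^ (n + 1) * (Nat.factorial (n + 1) : ℝ))) * (2 * ((n : ℝ) + 1)) = 1 / (2 ^ n * (Nat.factorial n : ℝ)) := by
    rw [Nat.factorial_succ]; push_cast; field_simp; ring
  have hP : legPoly (n + 1) = C (1 / (2 ^ n * (Nat.factorial n : ℝ))) * derivative^[n] (X * (X ^ 2 - 1) ^ n) := by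
    unfold legPoly
    rw [Function.iterate_succ_apply, h1, iterate_derivative_C_mul, ← mul_assoc, ← C_mul, hC]
  rw [hP]
  unfold legPoly
  rcases n with _ | n
  · simp
  have h2 : (X * X - 1) * derivative ((X ^ 2 - 1 : ℝ[X]) ^ (n + 1))
      = C (2 * ((n : ℝ) + 1)) * (X * (X ^ 2 - 1) ^ (n + 1)) := by
    simp [derivative_pow, C_mul, C_add]; ring
  have h3 := congrArg (derivative^[n + 1]) h2
  rw [sub_mul, one_mul, mul_assoc, iterate_derivative_sub, iterate_derivative_C_mul] at h3
  simp only [itX, itX', ← Function.iterate_succ_apply (f := derivative), Nat.succ_eq_add_one] at h3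
  simp only [itX, derivative_C_mul, ← Function.iterate_succ_apply' (f := derivative),
    Nat.succ_eq_add_one]
  push_cast [C_add, C_1, C_mul] at h3 ⊢
  simp only [map_ofNat] at h3
  linear_combination -C (1 / (2 ^ (n + 1) * (Nat.factorial (n + 1) : ℝ))) * h3

open Polynomial in
lemma leg_base3 (n : ℕ) : derivative (legPoly n) =
    X * derivative (legPoly (n + 1)) - C ((n : ℝ) + 1) * legPoly (n + 1) := by
  linear_combination leg_base2 n - X * leg_base1 n

open Polynomial in
lemma leg_base4 (n : ℕ) : (1 - X ^ 2) * derivative (legPoly (n + 1)) =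
    C ((n : ℝ) + 1) * (legPoly n - X * legPoly (n + 1)) := by
  linear_combination X * leg_base2 n + (1 - X ^ 2) * leg_base1 n

open Polynomial in
lemma leg_C (n m : ℕ) : derivative^[m + 1] (legPoly (n + 1)) =
    X * derivative^[m + 1] (legPoly n) + C ((n : ℝ) + m + 1) * derivative^[m] (legPoly n) := by
  induction m with
  | zero => simpa using leg_base1 n
  | succ m ih =>
    have := congrArg derivative ih
    rw [← Function.iterate_succ_apply' (f := derivative)] at this
    rw [this]
    simp only [derivative_add, derivative_mul, derivative_X, derivative_C,
      ← Function.iterate_succ_apply' (f := derivative), Nat.succ_eq_add_one]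
    push_cast [C_add, C_1]
    ring

open Polynomial in
lemma leg_E (n m : ℕ) : derivative^[m + 1] (legPoly n) =
    X * derivative^[m + 1] (legPoly (n + 1))
      - C ((n : ℝ) + 1 - m) * derivative^[m] (legPoly (n + 1)) := by
  induction m with
  | zero => simpa using leg_base3 n
  | succ m ih =>
    have := congrArg derivative ih
    rw [← Function.iterate_succ_apply' (f := derivative)] at this
    rw [this]
    simp only [derivative_sub, derivative_mul, derivative_X, derivative_C,
      ← Function.iterate_succ_apply' (f := derivative), Nat.succ_eq_add_one]
    push_cast [C_add, C_1, C_sub]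
    ring

open Polynomial in
lemma leg_B (n m : ℕ) : (1 - X ^ 2) * derivative^[m + 1] (legPoly n) =
    C ((n : ℝ) + 1 + m) * (X * derivative^[m] (legPoly n))
      - C ((n : ℝ) + 1 - m) * derivative^[m] (legPoly (n + 1)) := by
  induction m with
  | zero => have := leg_base2 n; simp at this ⊢; rw [this]; ring
  | succ m ih =>
    have := congrArg derivative ih
    have hc := leg_C n m
    simp only [derivative_sub, derivative_mul, derivative_X, derivative_C, derivative_one, derivative_X_pow,
      ← Function.iterate_succ_apply' (f := derivative), Nat.succ_eq_add_one] at this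
    push_cast [C_add, C_1, C_sub] at this hc ⊢
    simp only [map_ofNat] at this
    linear_combination this - hc

open Polynomial in
lemma leg_A (n m : ℕ) : (1 - X ^ 2) * derivative^[m + 1] (legPoly (n + 1)) =
    C ((n : ℝ) + 1 + m) * derivative^[m] (legPoly n)
      - C ((n : ℝ) + 1 - m) * (X * derivative^[m] (legPoly (n + 1))) := by
  induction m with
  | zero => have := leg_base4 n; simp at this ⊢; rw [this]; ring
  | succ m ih =>
    have := congrArg derivative ih
    have hc := leg_E n m
    simp only [derivative_sub, derivative_mul, derivative_X, derivative_C, derivative_one, derivative_X_pow,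
      ← Function.iterate_succ_apply' (f := derivative), Nat.succ_eq_add_one] at this
    push_cast [C_add, C_1, C_sub] at this hc ⊢
    simp only [map_ofNat] at this
    linear_combination this - hc

lemma assocLegendre_nat (n m : ℕ) (z : ℝ) :
    assocLegendre n m z = assocLegendreNat n m z := by
  unfold assocLegendre
  by_cases h : m ≤ n
  · have : (0 : ℤ) ≤ n ∧ |(m : ℤ)| ≤ n := by
      constructor
      · positivity
      · rw [abs_of_nonneg (by positivity)]; exact_mod_cast h
    rw [if_pos this]
    simp
  · have h' : ¬ ((0 : ℤ) ≤ n ∧ |(m : ℤ)| ≤ n) := by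
      rw [abs_of_nonneg (by positivity)]; push Not; intro _; exact_mod_cast not_le.mp h
    rw [if_neg h', assocLegendreNat_eq, legPoly_top n m (not_le.mp h)]
    simp

lemma assocNat_deriv (n m : ℕ) (z : ℝ) (hz : 0 < 1 - z ^ 2) :
    ∃ d, HasDerivAt (assocLegendreNat n m) d z ∧
      (1 - z ^ 2) * d = - m * z * assocLegendreNat n m z +
        (-1 : ℝ) ^ m * (1 - z ^ 2) ^ ((m : ℝ) / 2) *
        ((1 - z ^ 2) * (Polynomial.derivative^[m + 1] (legPoly n)).eval z) := by
  have h1 : HasDerivAt (fun y : ℝ => 1 - y ^ 2) (-(2 * z)) z := by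
    simpa using ((hasDerivAt_id z).pow 2).const_sub 1
  have h2 := h1.rpow_const (p := (m : ℝ) / 2) (Or.inl hz.ne')
  have h3 := ((Polynomial.derivative^[m] (legPoly n)).hasDerivAt z)
  have h4 := (h2.const_mul ((-1 : ℝ) ^ m)).mul h3
  have he : assocLegendreNat n m = (fun y => (-1 : ℝ) ^ m * (1 - y ^ 2) ^ ((m : ℝ) / 2)) *
      fun y => (Polynomial.derivative^[m] (legPoly n)).eval y := by
    funext y; simp [assocLegendreNat_eq]
  refine ⟨_, he ▸ h4, ?_⟩
  rw [assocLegendreNat_eq, Function.iterate_succ_apply', Real.rpow_sub_one hz.ne']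
  field_simp

lemma assocNat_B (n m : ℕ) (z d : ℝ) (hz : 0 < 1 - z ^ 2)
    (hd : HasDerivAt (assocLegendreNat n m) d z) :
    (1 - z ^ 2) * d - (n + 1) * z * assocLegendreNat n m z =
      - (n - m + 1) * assocLegendreNat (n + 1) m z := by
  obtain ⟨d', hd', h⟩ := assocNat_deriv n m z hz
  obtain rfl := hd.unique hd'
  have hB := congrArg (Polynomial.eval z) (leg_B n m)
  simp only [Polynomial.eval_mul, Polynomial.eval_sub, Polynomial.eval_one, Polynomial.eval_pow,
    Polynomial.eval_X, Polynomial.eval_C] at hB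
  rw [h, hB]
  simp only [assocLegendreNat_eq]
  ring

lemma assocNat_A (n m : ℕ) (z d : ℝ) (hz : 0 < 1 - z ^ 2)
    (hd : HasDerivAt (assocLegendreNat (n + 1) m) d z) :
    (1 - z ^ 2) * d + (n + 1) * z * assocLegendreNat (n + 1) m z =
      (n + 1 + m) * assocLegendreNat n m z := by
  obtain ⟨d', hd', h⟩ := assocNat_deriv (n + 1) m z hz
  obtain rfl := hd.unique hd'
  have hB := congrArg (Polynomial.eval z) (leg_A n m)
  simp only [Polynomial.eval_mul, Polynomial.eval_sub, Polynomial.eval_one, Polynomial.eval_pow,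
    Polynomial.eval_X, Polynomial.eval_C] at hB
  rw [h, hB]
  simp only [assocLegendreNat_eq]
  ring

lemma gamma_up (n m : ℕ) (h : m ≤ n) :
    Real.sqrt ((((n : ℝ) + m + 1) * ((n : ℝ) - m + 1)) / ((2 * (n : ℝ) + 1) * (2 * (n : ℝ) + 3)))
      * sphGamma (n + 1) m = sphGamma n m * ((n - m + 1) / (2 * n + 1)) := by
  obtain ⟨j, rfl⟩ := Nat.exists_eq_add_of_le h
  unfold sphGamma
  have e1 : (((m + j : ℕ) : ℤ) + 1 - m).toNat = j + 1 := by omega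
  have e2 : (((m + j : ℕ) : ℤ) + 1 + m).toNat = m + j + m + 1 := by omega
  have e3 : (((m + j : ℕ) : ℤ) - m).toNat = j := by omega
  have e4 : (((m + j : ℕ) : ℤ) + m).toNat = m + j + m := by omega
  rw [e1, e2, e3, e4]
  have hq : (0 : ℝ) ≤ ((m + j : ℕ) - m + 1 : ℝ) / (2 * (m + j : ℕ) + 1) := by
    push_cast; apply div_nonneg <;> [skip; positivity]
    have : (0 : ℝ) ≤ j := by positivity
    linarith
  have hp : (0 : ℝ) ≤ ((((m + j : ℕ) : ℝ) + m + 1) * (((m + j : ℕ) : ℝ) - m + 1)) /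
      ((2 * ((m + j : ℕ) : ℝ) + 1) * (2 * ((m + j : ℕ) : ℝ) + 3)) := by
    have : ((m + j : ℕ) : ℝ) - m + 1 = j + 1 := by push_cast; ring
    rw [this]; positivity
  conv_rhs => rw [← Real.sqrt_sq hq]
  rw [← Real.sqrt_mul hp, ← Real.sqrt_mul (by positivity)]
  congr 1
  have : ((m + j : ℕ) : ℝ) - m + 1 = j + 1 := by push_cast; ring
  rw [this, Nat.factorial_succ, Nat.factorial_succ]
  push_cast
  have : (0:ℝ) < 2 * (m + j) + 3 := by positivity
  have : (0:ℝ) < 2 * (m + j + 1) + 1 := by positivity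
  have : (0:ℝ) < 2 * (m + j) + 1 := by positivity
  have : (0:ℝ) < m + j + m + 1 := by positivity
  have := Real.pi_pos
  field_simp
  ring

lemma gamma_down (n m : ℕ) (h : m ≤ n) :
    Real.sqrt ((((n : ℝ) + 1 + m) * ((n : ℝ) + 1 - m)) / ((2 * ((n : ℝ) + 1) + 1) * (2 * ((n : ℝ) + 1) - 1)))
      * sphGamma n m = sphGamma (n + 1) m * ((n + 1 + m) / (2 * (n + 1) + 1)) := by
  obtain ⟨j, rfl⟩ := Nat.exists_eq_add_of_le h
  unfold sphGamma
  have e1 : (((m + j : ℕ) : ℤ) + 1 - m).toNat = j + 1 := by omega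
  have e2 : (((m + j : ℕ) : ℤ) + 1 + m).toNat = m + j + m + 1 := by omega
  have e3 : (((m + j : ℕ) : ℤ) - m).toNat = j := by omega
  have e4 : (((m + j : ℕ) : ℤ) + m).toNat = m + j + m := by omega
  rw [e1, e2, e3, e4]
  have hq : (0 : ℝ) ≤ ((m + j : ℕ) + 1 + m : ℝ) / (2 * ((m + j : ℕ) + 1) + 1) := by positivity
  have t1 : ((m + j : ℕ) : ℝ) + 1 - m = j + 1 := by push_cast; ring
  have t2 : 2 * (((m + j : ℕ) : ℝ) + 1) - 1 = 2 * (m + j) + 1 := by push_cast; ring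
  conv_rhs => rw [← Real.sqrt_sq hq]
  rw [t1, t2, ← Real.sqrt_mul (by positivity), ← Real.sqrt_mul (by push_cast; positivity)]
  congr 1
  rw [Nat.factorial_succ, Nat.factorial_succ]
  push_cast
  have : (0:ℝ) < 2 * (m + j + 1) + 1 := by positivity
  have : (0:ℝ) < 2 * (m + j) + 1 := by positivity
  have : (0:ℝ) < m + j + m + 1 := by positivity
  have := Real.pi_pos
  field_simp
  ring

/-- normalised associated Legendre function -/
noncomputable def nAL (n m : ℤ) (z : ℝ) : ℝ := sphGamma n m * assocLegendre n m z

lemma nAL_neg (n : ℤ) (m : ℕ) (z : ℝ) : nAL n (-m) z = (-1) ^ m * nAL n m z := by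
  unfold nAL
  rcases Nat.eq_zero_or_pos m with rfl | hm
  · simp
  by_cases h : 0 ≤ n ∧ |(m : ℤ)| ≤ n
  · obtain ⟨h0, h1⟩ := h
    lift n to ℕ using h0
    rw [assocLegendre_nat]
    unfold assocLegendre
    rw [if_pos ⟨by positivity, by rwa [abs_neg]⟩, if_neg (by omega)]
    simp only [neg_neg, Int.toNat_natCast, sub_neg_eq_add, ← sub_eq_add_neg]
    have hl : m ≤ n := by rw [abs_of_nonneg (by positivity)] at h1; exact_mod_cast h1
    have key : sphGamma n (-m) * ((Nat.factorial (n - m : ℤ).toNat : ℝ) / (Nat.factorial (n + m : ℤ).toNat : ℝ)) = sphGamma n m := by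
      unfold sphGamma
      simp only [sub_neg_eq_add, ← sub_eq_add_neg]
      have hq : (0 : ℝ) ≤ (Nat.factorial (n - m : ℤ).toNat : ℝ) / (Nat.factorial (n + m : ℤ).toNat : ℝ) := by positivity
      conv_lhs => rw [← Real.sqrt_sq hq]
      rw [← Real.sqrt_mul (by positivity)]
      congr 1
      have := Real.pi_pos
      field_simp
    rw [← key]; ring
  · unfold assocLegendre
    rw [if_neg (by rwa [abs_neg]), if_neg h]; simp

lemma nAL_rec_nat (n m : ℕ) (hm : m ≤ n) (z : ℝ) (hz : 0 < 1 - z ^ 2) :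
    ∃ d, HasDerivAt (nAL n m) d z ∧
      (1 - z ^ 2) * d + n * z * nAL n m z = (2 * n + 1) *
        (Real.sqrt ((((n : ℝ) + m) * ((n : ℝ) - m)) / ((2 * (n : ℝ) + 1) * (2 * (n : ℝ) - 1)))
          * nAL (n - 1) m z) ∧
      (1 - z ^ 2) * d - (n + 1) * z * nAL n m z = -((2 * n + 1) *
        (Real.sqrt ((((n : ℝ) + m + 1) * ((n : ℝ) - m + 1)) / ((2 * (n : ℝ) + 1) * (2 * (n : ℝ) + 3)))
          * nAL (n + 1) m z)) := by
  obtain ⟨d, hd, -⟩ := assocNat_deriv n m z hz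
  have hB := assocNat_B n m z d hz hd
  have hfun : nAL n m = fun y => sphGamma n m * assocLegendreNat n m y := by
    funext y; rw [nAL, assocLegendre_nat]
  refine ⟨sphGamma n m * d, hfun ▸ hd.const_mul _, ?_, ?_⟩
  · rcases n with _ | n
    · obtain rfl : m = 0 := by omega
      obtain ⟨d', hd', h⟩ := assocNat_deriv 0 0 z hz
      obtain rfl := hd.unique hd'
      rw [legPoly_top 0 1 (by norm_num)] at h
      have : d = 0 := by simpa [hz.ne'] using h
      simp [this]
    · have hA := assocNat_A n m z d hz hd
      rw [hfun]
      have e : (((n + 1 : ℕ) : ℤ) - 1) = (n : ℤ) := by push_cast; ring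
      rw [e, nAL, assocLegendre_nat]
      rcases Nat.lt_or_ge n m with hlt | hge
      · have hz0 : assocLegendreNat n m z = 0 := by
          rw [assocLegendreNat_eq, legPoly_top n m hlt]; simp
        rw [hz0] at hA ⊢
        push_cast
        linear_combination sphGamma (n + 1) m * hA
      · have hg := gamma_down n m hge
        have hne : (2 * ((n : ℝ) + 1) + 1) ≠ 0 := by positivity
        push_cast
        rw [← mul_assoc (Real.sqrt _), hg]
        field_simp
        linear_combination sphGamma (n + 1) m * hA
  · have e : ((n : ℤ) + 1) = ((n + 1 : ℕ) : ℤ) := by push_cast; ring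
    have hg := gamma_up n m hm
    have hne : (2 * (n : ℝ) + 1) ≠ 0 := by positivity
    rw [hfun]
    have : nAL (n + 1) m z = sphGamma (n + 1) m * assocLegendreNat (n + 1) m z := by
      rw [nAL]; conv_lhs => rw [e, assocLegendre_nat]
      simp
    rw [this, ← mul_assoc (Real.sqrt _), hg]
    field_simp
    linear_combination sphGamma n m * hB

lemma nAL_rec (n m : ℤ) (hn : 0 ≤ n) (hm : |m| ≤ n) (z : ℝ) (hz : 0 < 1 - z ^ 2) :
    ∃ d, HasDerivAt (nAL n m) d z ∧
      (1 - z ^ 2) * d + n * z * nAL n m z = (2 * n + 1) *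
        (Real.sqrt ((((n : ℝ) + m) * ((n : ℝ) - m)) / ((2 * (n : ℝ) + 1) * (2 * (n : ℝ) - 1)))
          * nAL (n - 1) m z) ∧
      (1 - z ^ 2) * d - (n + 1) * z * nAL n m z = -((2 * n + 1) *
        (Real.sqrt ((((n : ℝ) + m + 1) * ((n : ℝ) - m + 1)) / ((2 * (n : ℝ) + 1) * (2 * (n : ℝ) + 3)))
          * nAL (n + 1) m z)) := by
  lift n to ℕ using hn
  obtain ⟨M, rfl | rfl⟩ := m.eq_nat_or_neg
  · have := nAL_rec_nat n M (by rw [abs_of_nonneg (by positivity)] at hm; exact_mod_cast hm) z hz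
    simpa using this
  · rw [abs_neg, abs_of_nonneg (by positivity)] at hm
    obtain ⟨d, hd, h1, h2⟩ := nAL_rec_nat n M (by exact_mod_cast hm) z hz
    have hfun : nAL n (-M) = fun y => (-1) ^ M * nAL n M y := by
      funext y; rw [nAL_neg]
    refine ⟨(-1) ^ M * d, hfun ▸ hd.const_mul _, ?_, ?_⟩
    · simp only [nAL_neg]
      push_cast
      rw [show ((n : ℝ) + -M) * (n - -M) = (n + M) * (n - M) by ring]
      linear_combination (-1) ^ M * h1
    · simp only [nAL_neg]
      push_cast
      rw [show ((n : ℝ) + -M + 1) * (n - -M + 1) = (n + M + 1) * (n - M + 1) by ring]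
      linear_combination (-1) ^ M * h2

lemma exp_arg_zpow (m : ℤ) (w : ℂ) (hw : w ≠ 0) :
    Complex.exp (Complex.I * (m : ℂ) * (Complex.arg w : ℂ)) = (w / (‖w‖ : ℂ)) ^ m := by
  have h : w / (‖w‖ : ℂ) = Complex.exp (Complex.arg w * Complex.I) := by
    have hn : (‖w‖ : ℂ) ≠ 0 := by simpa using hw
    rw [div_eq_iff hn, mul_comm]
    exact (Complex.norm_mul_exp_arg_mul_I w).symm
  rw [h, ← Complex.exp_int_mul]
  congr 1; ring

lemma sphG_eq (g : ℤ → ℝ → ℂ) (k : ℝ) (n m : ℤ) (y : EuclideanSpace ℝ (Fin 3)) :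
    sphG g k n m y = g n (k * ‖y‖) *
      (Complex.exp (Complex.I * (m : ℂ) *
        (Complex.arg ((y 0 : ℂ) + (y 1 : ℂ) * Complex.I) : ℂ)) *
        ((nAL n m (y 2 / ‖y‖) : ℝ) : ℂ)) := by
  have hb : |y 2 / ‖y‖| ≤ 1 := by
    rw [abs_div, abs_norm]
    apply div_le_one_of_le₀ _ (norm_nonneg y)
    exact PiLp.norm_apply_le y 2
  have := abs_le.mp hb
  rw [sphG, sphHarm, Real.cos_arccos this.1 this.2, nAL]
  push_cast
  ring

lemma sphHarm_eq (n m : ℤ) (θ φ : ℝ) : sphHarm n m θ φ =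
    Complex.exp (Complex.I * (m : ℂ) * (φ : ℂ)) * ((nAL n m (Real.cos θ) : ℝ) : ℂ) := by
  rw [sphHarm, nAL]; push_cast; ring

/-- `∂_{x₃} G(x) = k (g_{n-1}(kr) e_{n-1}^m Y_{n-1}^m(θ,φ) − g_{n+1}(kr) f_{n+1}^m Y_{n+1}^m(θ,φ))`
for a family `g` satisfying the spherical Bessel recurrences. -/
theorem sphG_deriv_x3
    (g : ℤ → ℝ → ℂ)
    (hdiff : ∀ ν : ℤ, DifferentiableOn ℝ (g ν) (Set.Ioi 0))
    (hg1 : ∀ ν : ℤ, 0 ≤ ν → ∀ r : ℝ, 0 < r →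
      g ν r / (r : ℂ) = (g (ν - 1) r + g (ν + 1) r) / (2 * (ν : ℂ) + 1))
    (hg2 : ∀ ν : ℤ, 0 ≤ ν → ∀ r : ℝ, 0 < r →
      deriv (g ν) r = ((ν : ℂ) * g (ν - 1) r - ((ν : ℂ) + 1) * g (ν + 1) r) / (2 * (ν : ℂ) + 1))
    (k : ℝ) (hk : 0 < k) (n m : ℤ) (hn : 0 ≤ n) (hm : |m| ≤ n)
    (r θ φ : ℝ) (hr : 0 < r) (hθ : θ ∈ Set.Ioo (0 : ℝ) Real.pi)
    (x : EuclideanSpace ℝ (Fin 3))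
    (hx0 : x 0 = r * Real.cos φ * Real.sin θ)
    (hx1 : x 1 = r * Real.sin φ * Real.sin θ)
    (hx2 : x 2 = r * Real.cos θ) :
    fderiv ℝ (sphG g k n m) x (EuclideanSpace.single 2 1) =
      (k : ℂ) *
        (g (n - 1) (k * r) *
            ((Real.sqrt ((((n : ℝ) + m) * ((n : ℝ) - m)) /
              ((2 * (n : ℝ) + 1) * (2 * (n : ℝ) - 1))) : ℝ) : ℂ) *
            sphHarm (n - 1) m θ φ -
          g (n + 1) (k * r) *
            ((Real.sqrt ((((n : ℝ) + m + 1) * ((n : ℝ) - m + 1)) /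
              ((2 * (n : ℝ) + 1) * (2 * (n : ℝ) + 3))) : ℝ) : ℂ) *
            sphHarm (n + 1) m θ φ) := by
  have hs : 0 < Real.sin θ := Real.sin_pos_of_mem_Ioo hθ
  have hsc := Real.sin_sq_add_cos_sq θ
  have hscφ := Real.sin_sq_add_cos_sq φ
  have hz : 0 < 1 - Real.cos θ ^ 2 := by nlinarith
  have hnorm : ‖x‖ = r := by
    rw [EuclideanSpace.norm_eq, Fin.sum_univ_three]
    simp only [Real.norm_eq_abs, sq_abs, hx0, hx1, hx2]
    rw [show (r * Real.cos φ * Real.sin θ) ^ 2 + (r * Real.sin φ * Real.sin θ) ^ 2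
      + (r * Real.cos θ) ^ 2 = r ^ 2 by
        linear_combination r ^ 2 * Real.sin θ ^ 2 * hscφ + r ^ 2 * hsc]
    exact Real.sqrt_sq hr.le
  have hxne : x ≠ 0 := by
    rw [← norm_pos_iff, hnorm]; exact hr
  have hcos : x 2 / ‖x‖ = Real.cos θ := by rw [hnorm, hx2]; field_simp
  have hw : (x 0 : ℂ) + (x 1 : ℂ) * Complex.I =
      ((r * Real.sin θ : ℝ) : ℂ) * Complex.exp (φ * Complex.I) := by
    rw [hx0, hx1, Complex.exp_mul_I]; push_cast; ring
  have hrs : 0 < r * Real.sin θ := mul_pos hr hs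
  have hwne : (x 0 : ℂ) + (x 1 : ℂ) * Complex.I ≠ 0 := by
    rw [hw]; exact mul_ne_zero (by exact_mod_cast hrs.ne') (Complex.exp_ne_zero _)
  have hwn : ‖(x 0 : ℂ) + (x 1 : ℂ) * Complex.I‖ = r * Real.sin θ := by
    rw [hw, norm_mul, Complex.norm_exp_ofReal_mul_I, Complex.norm_real, mul_one,
      Real.norm_eq_abs, abs_of_pos hrs]
  have hE : Complex.exp (Complex.I * (m : ℂ) *
      (Complex.arg ((x 0 : ℂ) + (x 1 : ℂ) * Complex.I) : ℂ)) =
      Complex.exp (Complex.I * (m : ℂ) * (φ : ℂ)) := by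
    rw [exp_arg_zpow m _ hwne, hwn, hw, mul_div_cancel_left₀ _ (by exact_mod_cast hrs.ne'),
      ← Complex.exp_int_mul]
    congr 1; ring
  obtain ⟨d, hd, hA, hB⟩ := nAL_rec n m hn hm (Real.cos θ) hz
  have hkr : 0 < k * r := mul_pos hk hr
  have hgd : DifferentiableAt ℝ (g n) (k * r) :=
    (hdiff n).differentiableAt (Ioi_mem_nhds hkr)
  -- differentiability
  have hN : DifferentiableAt ℝ (fun y : EuclideanSpace ℝ (Fin 3) => ‖y‖) x :=
    differentiableAt_id.norm ℝ hxne
  have hc (i : Fin 3) : DifferentiableAt ℝ (fun y : EuclideanSpace ℝ (Fin 3) => y i) x := by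
    fun_prop
  have hcC (i : Fin 3) :
      DifferentiableAt ℝ (fun y : EuclideanSpace ℝ (Fin 3) => ((y i : ℝ) : ℂ)) x :=
    Complex.ofRealCLM.differentiableAt.comp x (hc i)
  have hW : DifferentiableAt ℝ
      (fun y : EuclideanSpace ℝ (Fin 3) => (y 0 : ℂ) + (y 1 : ℂ) * Complex.I) x :=
    (hcC 0).add ((hcC 1).mul_const _)
  have hWn : DifferentiableAt ℝ (fun y : EuclideanSpace ℝ (Fin 3) =>
      ((‖(y 0 : ℂ) + (y 1 : ℂ) * Complex.I‖ : ℝ) : ℂ)) x :=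
    Complex.ofRealCLM.differentiableAt.comp x (hW.norm ℝ hwne)
  have hwn0 : ((‖(x 0 : ℂ) + (x 1 : ℂ) * Complex.I‖ : ℝ) : ℂ) ≠ 0 := by
    rw [hwn]; exact_mod_cast hrs.ne'
  have hQ : DifferentiableAt ℝ (fun y : EuclideanSpace ℝ (Fin 3) =>
      ((y 0 : ℂ) + (y 1 : ℂ) * Complex.I) /
      ((‖(y 0 : ℂ) + (y 1 : ℂ) * Complex.I‖ : ℝ) : ℂ)) x := by
    simp only [div_eq_mul_inv]
    exact hW.mul (hWn.inv hwn0)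
  have hZ : DifferentiableAt ℝ (fun y : EuclideanSpace ℝ (Fin 3) =>
      (((y 0 : ℂ) + (y 1 : ℂ) * Complex.I) /
      ((‖(y 0 : ℂ) + (y 1 : ℂ) * Complex.I‖ : ℝ) : ℂ)) ^ m) x := by
    have h1 : DifferentiableAt ℂ (fun u : ℂ => u ^ m)
        (((x 0 : ℂ) + (x 1 : ℂ) * Complex.I) /
          ((‖(x 0 : ℂ) + (x 1 : ℂ) * Complex.I‖ : ℝ) : ℂ)) :=
      differentiableAt_zpow.mpr (Or.inl (div_ne_zero hwne hwn0))
    exact (h1.restrictScalars ℝ).comp x hQ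
  have hEd : DifferentiableAt ℝ (fun y : EuclideanSpace ℝ (Fin 3) =>
      Complex.exp (Complex.I * (m : ℂ) *
        (Complex.arg ((y 0 : ℂ) + (y 1 : ℂ) * Complex.I) : ℂ))) x := by
    refine hZ.congr_of_eventuallyEq ?_
    filter_upwards [hW.continuousAt.eventually_ne hwne] with y hy
    exact exp_arg_zpow m _ hy
  have hP : DifferentiableAt ℝ (fun y : EuclideanSpace ℝ (Fin 3) =>
      ((nAL n m (y 2 / ‖y‖) : ℝ) : ℂ)) x := by
    have h1 : DifferentiableAt ℝ (fun y : EuclideanSpace ℝ (Fin 3) => y 2 / ‖y‖) x := by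
      simp only [div_eq_mul_inv]
      exact (hc 2).mul (hN.inv (show ‖x‖ ≠ 0 by rw [hnorm]; exact hr.ne'))
    have h2 : DifferentiableAt ℝ (nAL n m) (x 2 / ‖x‖) := by
      rw [hcos]; exact hd.differentiableAt
    have h3 : DifferentiableAt ℝ (fun y : EuclideanSpace ℝ (Fin 3) => nAL n m (y 2 / ‖y‖)) x :=
      DifferentiableAt.comp (g := nAL n m) x h2 h1
    exact Complex.ofRealCLM.differentiableAt.comp x h3
  have hG : DifferentiableAt ℝ (fun y : EuclideanSpace ℝ (Fin 3) => g n (k * ‖y‖)) x := by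
    have h2 : DifferentiableAt ℝ (g n) (k * ‖x‖) := by rw [hnorm]; exact hgd
    exact h2.comp x (hN.const_mul k)
  have hfun : sphG g k n m = fun y => g n (k * ‖y‖) *
      (Complex.exp (Complex.I * (m : ℂ) *
        (Complex.arg ((y 0 : ℂ) + (y 1 : ℂ) * Complex.I) : ℂ)) *
        ((nAL n m (y 2 / ‖y‖) : ℝ) : ℂ)) := by
    funext y; exact sphG_eq g k n m y
  have hD : DifferentiableAt ℝ (sphG g k n m) x := by
    rw [hfun]; exact hG.mul (hEd.mul hP)
  rw [← hD.lineDeriv_eq_fderiv, lineDeriv]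
  -- the line
  have hline : (fun t : ℝ => sphG g k n m (x + t • EuclideanSpace.single 2 1)) =
      fun t : ℝ => g n (k * ‖x + t • EuclideanSpace.single (2 : Fin 3) (1 : ℝ)‖) *
        (Complex.exp (Complex.I * (m : ℂ) * (φ : ℂ)) *
        ((nAL n m ((x 2 + t) / ‖x + t • EuclideanSpace.single (2 : Fin 3) (1 : ℝ)‖) : ℝ) : ℂ)) := by
    funext t
    rw [sphG_eq, ← hE]
    simp
  have hρ : HasDerivAt (fun t : ℝ => ‖x + t • EuclideanSpace.single (2 : Fin 3) (1 : ℝ)‖)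
      (Real.cos θ) 0 := by
    have he : (fun t : ℝ => ‖x + t • EuclideanSpace.single (2 : Fin 3) (1 : ℝ)‖) =
        fun t : ℝ => Real.sqrt ((x 0) ^ 2 + (x 1) ^ 2 + (x 2 + t) ^ 2) := by
      funext t
      rw [EuclideanSpace.norm_eq, Fin.sum_univ_three]
      simp
    have hr2 : (x 0) ^ 2 + (x 1) ^ 2 + (x 2 + 0) ^ 2 = r ^ 2 := by
      rw [hx0, hx1, hx2]
      linear_combination r ^ 2 * Real.sin θ ^ 2 * hscφ + r ^ 2 * hsc
    have h1 : HasDerivAt (fun t : ℝ => (x 0) ^ 2 + (x 1) ^ 2 + (x 2 + t) ^ 2)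
        (2 * (r * Real.cos θ)) 0 := by
      have := (((hasDerivAt_id (0 : ℝ)).const_add (x 2)).pow 2).const_add ((x 0) ^ 2 + (x 1) ^ 2)
      simpa [hx2] using this
    rw [he]
    have h2 := h1.sqrt (by rw [hr2]; positivity)
    rw [hr2, Real.sqrt_sq hr.le] at h2
    convert h2 using 1
    field_simp
  have hρ0 : ‖x + (0 : ℝ) • EuclideanSpace.single (2 : Fin 3) (1 : ℝ)‖ = r := by
    simp [hnorm]
  have hζ : HasDerivAt
      (fun t : ℝ => (x 2 + t) / ‖x + t • EuclideanSpace.single (2 : Fin 3) (1 : ℝ)‖)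
      ((1 - Real.cos θ ^ 2) / r) 0 := by
    have h1 := ((hasDerivAt_id (0 : ℝ)).const_add (x 2)).div hρ (by rw [hρ0]; exact hr.ne')
    refine HasDerivAt.congr_deriv h1 ?_
    rw [hρ0]
    simp only [id, hx2]
    field_simp
    ring
  have hζ0 : (x 2 + 0) / ‖x + (0 : ℝ) • EuclideanSpace.single (2 : Fin 3) (1 : ℝ)‖
      = Real.cos θ := by
    rw [hρ0, add_zero, ← hcos, hnorm]
  have hPt : HasDerivAt (fun t : ℝ =>
      ((nAL n m ((x 2 + t) / ‖x + t • EuclideanSpace.single (2 : Fin 3) (1 : ℝ)‖) : ℝ) : ℂ))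
      ((d * ((1 - Real.cos θ ^ 2) / r) : ℝ) : ℂ) 0 := by
    rw [← hζ0] at hd
    have := HasDerivAt.comp (0 : ℝ) hd hζ
    exact this.ofReal_comp
  have hGt : HasDerivAt (fun t : ℝ =>
      g n (k * ‖x + t • EuclideanSpace.single (2 : Fin 3) (1 : ℝ)‖))
      ((k * Real.cos θ) • deriv (g n) (k * r)) 0 := by
    have h1 := hgd.hasDerivAt
    have h2 := hρ.const_mul k
    have h3 : HasDerivAt (g n) (deriv (g n) (k * r))
        (k * ‖x + (0 : ℝ) • EuclideanSpace.single (2 : Fin 3) (1 : ℝ)‖) := by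
      rw [hρ0]; exact h1
    exact HasDerivAt.scomp (0 : ℝ) h3 h2
  have hfin := hGt.mul (hPt.const_mul (Complex.exp (Complex.I * (m : ℂ) * (φ : ℂ))))
  rw [hline]
  refine hfin.deriv.trans ?_
  rw [hζ0, hρ0, sphHarm_eq, sphHarm_eq, hg2 n hn _ hkr]
  have hg := hg1 n hn _ hkr
  have hAC := congrArg (fun u : ℝ => (u : ℂ)) hA
  have hBC := congrArg (fun u : ℝ => (u : ℂ)) hB
  simp only [Complex.ofReal_mul, Complex.ofReal_add, Complex.ofReal_sub, Complex.ofReal_neg,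
    Complex.ofReal_pow, Complex.ofReal_one, Complex.ofReal_ofNat, Complex.ofReal_intCast,
    Complex.ofReal_div, Complex.real_smul] at hAC hBC hg ⊢
  have hnn : (2 * (n : ℂ) + 1) ≠ 0 := by
    have : (2 * n + 1 : ℤ) ≠ 0 := by omega
    exact_mod_cast this
  have hrC : (r : ℂ) ≠ 0 := by exact_mod_cast hr.ne'
  have hkC : (k : ℂ) ≠ 0 := by exact_mod_cast hk.ne'
  have hg' : g n (k * r) = (k * r) * ((g (n - 1) (k * r) + g (n + 1) (k * r)) / (2 * (n : ℂ) + 1)) := by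
    rw [← hg]; field_simp
  rw [hg']
  generalize ((Real.sqrt _ : ℝ) : ℂ) = e at hAC ⊢
  generalize ((Real.sqrt _ : ℝ) : ℂ) = f at hBC ⊢
  clear hg hg'
  generalize (2 * (n : ℂ) + 1) = q at hAC hBC hnn ⊢
  field_simp
  linear_combination g (n - 1) (k * r) * hAC + g (n + 1) (k * r) * hBC
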